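/- Let H ∈ C^∞(ℝ²) be convex, let U ⊆ ℝ² be a domain, and let v ∈ C^∞(U). Then in U one has the divergence identity 2·(−det D²v)·det(D²H(Dv)) = div( D²H(Dv)·D[H(Dv)] − div(D_pH(Dv))·D_pH(Dv) ), where D[H(Dv)] is the gradient of x ↦ H(Dv(x)). -/

import Mathlib

open MeasureTheory Set Filter Topology Metric Bornology
open scoped Classical ENNReal NNReal

noncomputable section

/-- The Euclidean plane `ℝ²`. -/
abbrev E2 := EuclideanSpace ℝ (Fin 2)

/-- `i`-th standard coordinate vector of `ℝ²`. -/
def e2 (i : Fin 2) : E2 := EuclideanSpace.single i 1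

/-- The partial derivative `∂f/∂xᵢ` (via the total Fréchet derivative; junk value `0`
where `f` is not differentiable). -/
def pd (f : E2 → ℝ) (i : Fin 2) (x : E2) : ℝ := fderiv ℝ f x (e2 i)

/-- The gradient of `f` as a vector in `Fin 2 → ℝ`. -/
def gradV (f : E2 → ℝ) (x : E2) : Fin 2 → ℝ := fun i => pd f i x

/-- The gradient of `f` as an element of `ℝ²`. -/
def gradE (f : E2 → ℝ) (x : E2) : E2 := (EuclideanSpace.equiv (Fin 2) ℝ).symm (gradV f x)

/-- Second partial derivative `∂ᵢ∂ⱼ f`. -/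
def pd2 (f : E2 → ℝ) (i j : Fin 2) (x : E2) : ℝ := pd (fun y => pd f j y) i x

/-- Hessian matrix of `f` at `x`. -/
def hessM (f : E2 → ℝ) (x : E2) : Matrix (Fin 2) (Fin 2) ℝ := Matrix.of fun i j => pd2 f i j x

/-- Operator norm of the second derivative of `f` at `x`. -/
def hessNorm (f : E2 → ℝ) (x : E2) : ℝ := ‖fderiv ℝ (fderiv ℝ f) x‖

/-- Euclidean norm of a vector in `Fin 2 → ℝ`. -/
def vnorm (a : Fin 2 → ℝ) : ℝ := Real.sqrt (∑ i, a i ^ 2)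

/-- The Aronsson operator `𝒜_H[v] = Σ_{i,j} H_{p_i}(Dv) H_{p_j}(Dv) v_{x_i x_j}`. -/
def aronsson (H v : E2 → ℝ) (x : E2) : ℝ :=
  ∑ i, ∑ j, pd H i (gradE v x) * pd H j (gradE v x) * pd2 v i j x

/-- `div (D_pH(Dv))`. -/
def divDpH (H v : E2 → ℝ) (x : E2) : ℝ := ∑ i, pd (fun y => pd H i (gradE v y)) i x

/-- The `L^∞` norm (essential supremum) of `f` on `V`. -/
def supNorm (f : E2 → ℝ) (V : Set E2) : ℝ := (eLpNorm f ⊤ (volume.restrict V)).toReal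

/-- The supremum norm of `f` on `K`. -/
def supAbs (K : Set E2) (f : E2 → ℝ) : ℝ := sSup ((fun x => |f x|) '' K)

/-- The `L^q` norm of `f` on `V`. -/
def lpNorm (q : ℝ) (V : Set E2) (f : E2 → ℝ) : ℝ := (∫ x in V, |f x| ^ q) ^ (1 / q)

/-- The integral average `⨍_V f`. -/
def avgOn (V : Set E2) (f : E2 → ℝ) : ℝ := (volume V).toReal⁻¹ * ∫ x in V, f x

/-- Distance between two sets. -/
def setDist (s t : Set E2) : ℝ := sInf {d : ℝ | ∃ x ∈ s, ∃ y ∈ t, d = dist x y}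

/-- `f` is locally Lipschitz on `O`. -/
def LocLipOn (O : Set E2) (f : E2 → ℝ) : Prop :=
  ∀ x ∈ O, ∃ K : ℝ≥0, ∃ t ∈ 𝓝[O] x, LipschitzOnWith K f t

/-- `u` is an absolute minimizer for the Hamiltonian `H` in `Ω`. -/
def IsAbsMin (H : E2 → ℝ) (Ω : Set E2) (u : E2 → ℝ) : Prop :=
  LocLipOn Ω u ∧
  ∀ V : Set E2, IsOpen V → IsBounded V → closure V ⊆ Ω →
    ∀ v : E2 → ℝ, LocLipOn V v → ContinuousOn v (closure V) →
      (∀ x ∈ frontier V, v x = u x) →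
      supNorm (fun x => H (gradE u x)) V ≤ supNorm (fun x => H (gradE v x)) V

/-- The hypotheses (H1')&(H2): `H(0) = 0 = min H`, and `H` is globally strongly
convex and strongly concave. -/
def StrongH (H : E2 → ℝ) : Prop :=
  H 0 = 0 ∧ (∀ p, 0 ≤ H p) ∧
  ∃ lam Lam : ℝ, 0 < lam ∧ lam ≤ Lam ∧
    ConvexOn ℝ univ (fun p => H p - lam / 2 * ‖p‖ ^ 2) ∧
    ConvexOn ℝ univ (fun p => Lam / 2 * ‖p‖ ^ 2 - H p)

/-- The hypotheses (H1)&(H2): `H(0) = 0 = min H`, and `H` is locally strongly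
convex and locally strongly concave. -/
def LocStrongH (H : E2 → ℝ) : Prop :=
  H 0 = 0 ∧ (∀ p, 0 ≤ H p) ∧
  ∀ K : Set E2, Convex ℝ K → IsBounded K →
    ∃ lam Lam : ℝ, 0 < lam ∧ 0 < Lam ∧
      ConvexOn ℝ K (fun p => H p - lam / 2 * ‖p‖ ^ 2) ∧
      ConvexOn ℝ K (fun p => Lam / 2 * ‖p‖ ^ 2 - H p)

/-- `λ_H(∞)`: the supremum of admissible global strong convexity constants. -/
def lamInf (H : E2 → ℝ) : ℝ :=
  sSup {l : ℝ | 0 < l ∧ ConvexOn ℝ univ (fun p => H p - l / 2 * ‖p‖ ^ 2)}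

/-- `Λ_H(∞)`: the infimum of admissible global strong concavity constants. -/
def LamInf (H : E2 → ℝ) : ℝ :=
  sInf {L : ℝ | 0 < L ∧ ConvexOn ℝ univ (fun p => L / 2 * ‖p‖ ^ 2 - H p)}

/-- `λ_H(R)`. -/
def lamR (H : E2 → ℝ) (R : ℝ) : ℝ :=
  ⨆ ε : {t : ℝ // 0 < t},
    sInf {l : ℝ | 0 < l ∧ ConvexOn ℝ (H ⁻¹' Ico 0 (R + ε.1)) (fun p => H p - l / 2 * ‖p‖ ^ 2)}

/-- `Λ_H(R)`. -/
def LamR (H : E2 → ℝ) (R : ℝ) : ℝ :=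
  ⨅ ε : {t : ℝ // 0 < t},
    sSup {L : ℝ | 0 < L ∧ ConvexOn ℝ (H ⁻¹' Ico 0 (R + ε.1)) (fun p => L / 2 * ‖p‖ ^ 2 - H p)}

/-- `τ̃_H(p)`. -/
def tauTilde (H : E2 → ℝ) (p : E2) : ℝ :=
  if p = 0 then 1 / 2
  else H p / ∑ i, (hessM H p)⁻¹.mulVec (gradV H p) i * gradV H p i

/-- `τ_H(R)` for twice differentiable `H`. -/
def tauR (H : E2 → ℝ) (R : ℝ) : ℝ := sInf {t : ℝ | ∃ p : E2, H p ≤ R ∧ t = tauTilde H p}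

/-- `τ_H(∞) = lim_{R → ∞} τ_H(R)`. -/
def tauInf (H : E2 → ℝ) : ℝ := ⨅ R : {r : ℝ // 0 ≤ r}, tauR H R.1

/-- A standard mollifier supported in the ball of radius `δ`. -/
def stdMollifier (δ : ℝ) : E2 → ℝ :=
  if h : 0 < δ then
    (⟨δ / 2, δ, by linarith, by linarith⟩ : ContDiffBump (0 : E2)).normed volume
  else 0

/-- Mollification `η_δ * H`. -/
def mollified (H : E2 → ℝ) (δ : ℝ) (p : E2) : ℝ := ∫ q, stdMollifier δ q * H (p - q)

/-- The unique minimum point `p^δ` of `η_δ * H` (junk value `0` if it does not exist). -/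
def minPt (H : E2 → ℝ) (δ : ℝ) : E2 :=
  if h : ∃ p : E2, (∀ q, mollified H δ p ≤ mollified H δ q) ∧
      ∀ p' : E2, (∀ q, mollified H δ p' ≤ mollified H δ q) → p' = p
  then h.choose else 0

/-- The standard smooth approximation `H^δ(p) = (η_δ*H)(p + p^δ) − (η_δ*H)(p^δ)`. -/
def smoothApprox (H : E2 → ℝ) (δ : ℝ) (p : E2) : ℝ :=
  mollified H δ (p + minPt H δ) - mollified H δ (minPt H δ)

/-- `τ_H(R) = sup_{ε>0} limsup_{δ→0} τ_{H^δ}(R+ε)` for merely continuous `H`. -/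
def tauC0 (H : E2 → ℝ) (R : ℝ) : ℝ :=
  ⨆ ε : {t : ℝ // 0 < t},
    Filter.limsup (fun δ => tauR (smoothApprox H δ) (R + ε.1)) (𝓝[>] (0 : ℝ))

/-- `φ` is a smooth test function with compact support contained in `O`. -/
def IsTestOn (O : Set E2) (φ : E2 → ℝ) : Prop :=
  ContDiff ℝ (⊤ : ℕ∞) φ ∧ HasCompactSupport φ ∧ tsupport φ ⊆ O

/-- `g` is the weak gradient of `f` on `O`. -/
def HasWeakGradOn (O : Set E2) (f : E2 → ℝ) (g : E2 → Fin 2 → ℝ) : Prop :=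
  ∀ φ : E2 → ℝ, IsTestOn O φ →
    ∀ i : Fin 2, ∫ x in O, f x * pd φ i x = - ∫ x in O, g x i * φ x

/-- `f ∈ L²_loc(O)`. -/
def MemL2loc (O : Set E2) (f : E2 → ℝ) : Prop :=
  ∀ V : Set E2, IsOpen V → IsBounded V → closure V ⊆ O →
    IntegrableOn (fun x => f x ^ 2) V volume

/-- `f ∈ W^{1,2}_loc(O)`. -/
def MemW12loc (O : Set E2) (f : E2 → ℝ) : Prop :=
  MemL2loc O f ∧ ∃ g : E2 → Fin 2 → ℝ, HasWeakGradOn O f g ∧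
    ∀ i, MemL2loc O (fun x => g x i)

/-- Convergence `f_s → f` in `L^t_loc(O)` for all `t ∈ [1,∞)`, as `s → 0⁺`. -/
def LtLocConv (O : Set E2) (fι : ℝ → E2 → ℝ) (f : E2 → ℝ) : Prop :=
  ∀ t : ℝ, 1 ≤ t → ∀ V : Set E2, IsOpen V → IsBounded V → closure V ⊆ O →
    Tendsto (fun s => ∫ x in V, |fι s x - f x| ^ t) (𝓝[>] (0 : ℝ)) (𝓝 0)

/-- Weak convergence `f_s → f` in `W^{1,2}_loc(O)` as `s → 0⁺`. -/
def WeakW12locConv (O : Set E2) (fι : ℝ → E2 → ℝ) (f : E2 → ℝ) : Prop :=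
  ∃ g : E2 → Fin 2 → ℝ, HasWeakGradOn O f g ∧
  ∃ gι : ℝ → E2 → Fin 2 → ℝ, (∀ s, HasWeakGradOn O (fι s) (gι s)) ∧
    ∀ V : Set E2, IsOpen V → IsBounded V → closure V ⊆ O →
      Tendsto (fun s => ∫ x in V, (fι s x - f x) ^ 2) (𝓝[>] (0 : ℝ)) (𝓝 0) ∧
      ∀ h : E2 → Fin 2 → ℝ, IntegrableOn (fun x => ∑ i, h x i ^ 2) V volume →
        Tendsto (fun s => ∫ x in V, ∑ i, gι s x i * h x i) (𝓝[>] (0 : ℝ))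
          (𝓝 (∫ x in V, ∑ i, g x i * h x i))

/-- `w` solves the Dirichlet problem `div(e^{H(Dw)/ε} D_pH(Dw)) = 0` in `U`, `w = u` on `∂U`. -/
def ExpSol (H : E2 → ℝ) (U : Set E2) (u : E2 → ℝ) (ε : ℝ) (w : E2 → ℝ) : Prop :=
  ContDiffOn ℝ (⊤ : ℕ∞) w U ∧ ContinuousOn w (closure U) ∧
  (∀ x ∈ U, ∑ i, pd (fun y => Real.exp (H (gradE w y) / ε) * pd H i (gradE w y)) i x = 0) ∧
  ∀ x ∈ frontier U, w x = u x

/-- `U` has a smooth boundary. -/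
def SmoothBoundary (U : Set E2) : Prop :=
  ∀ x ∈ frontier U, ∃ V : Set E2, ∃ φ : E2 → ℝ, IsOpen V ∧ x ∈ V ∧
    ContDiff ℝ (⊤ : ℕ∞) φ ∧ (∀ y ∈ V, fderiv ℝ φ y ≠ 0) ∧ U ∩ V = {y ∈ V | φ y < 0}

/-- The `C^{0,γ}` norm of `f` on `K`. -/
def holderNorm (γ : ℝ) (K : Set E2) (f : E2 → ℝ) : ℝ :=
  supAbs K f + sSup {c : ℝ | ∃ x ∈ K, ∃ y ∈ K, x ≠ y ∧ c = |f x - f y| / dist x y ^ γ}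

/-- The normalized density `σ^ε` of `e^{H(Dw)/ε}` over `U`. -/
def sigmaEps (H : E2 → ℝ) (U : Set E2) (w : E2 → ℝ) (ε : ℝ) (x : E2) : ℝ :=
  Real.exp (H (gradE w x) / ε) / ∫ y in U, Real.exp (H (gradE w y) / ε)

/-- The affine function `x ↦ c + ⟨b, x⟩`. -/
def affF (c : ℝ) (b : Fin 2 → ℝ) (x : E2) : ℝ :=
  c + ∑ i, b i * (EuclideanSpace.equiv (Fin 2) ℝ) x i


lemma ContDiffAt.pd {f : E2 → ℝ} {x : E2} (hf : ContDiffAt ℝ (⊤ : ℕ∞) f x) (i : Fin 2) :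
    ContDiffAt ℝ (⊤ : ℕ∞) (pd f i) x :=
  (hf.fderiv_right (m := (⊤ : ℕ∞)) (by simp)).clm_apply contDiffAt_const

lemma ContDiffAt.differentiableAt_of_smooth {F : Type*} [NormedAddCommGroup F] [NormedSpace ℝ F]
    {f : E2 → F} {x : E2} (hf : ContDiffAt ℝ (⊤ : ℕ∞) f x) : DifferentiableAt ℝ f x :=
  hf.differentiableAt (by simp)

lemma pd2_comm {f : E2 → ℝ} {x : E2} (hf : ContDiffAt ℝ (⊤ : ℕ∞) f x) (i j : Fin 2) :
    pd2 f i j x = pd2 f j i x := by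
  have hd : DifferentiableAt ℝ (fderiv ℝ f) x :=
    (hf.fderiv_right (m := (⊤ : ℕ∞)) (by simp)).differentiableAt_of_smooth
  have key : ∀ a b : Fin 2, pd2 f a b x = fderiv ℝ (fderiv ℝ f) x (e2 a) (e2 b) := by
    intro a b
    simp only [pd2, pd]
    rw [fderiv_clm_apply hd (differentiableAt_const _)]
    simp
  rw [key, key]
  exact hf.isSymmSndFDerivAt (by simpa using WithTop.coe_le_coe.2 (le_top : (2 : ℕ∞) ≤ ⊤)) _ _

lemma ContDiffAt.gradE {v : E2 → ℝ} {x : E2} (hv : ContDiffAt ℝ (⊤ : ℕ∞) v x) :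
    ContDiffAt ℝ (⊤ : ℕ∞) (gradE v) x :=
  (EuclideanSpace.equiv (Fin 2) ℝ).symm.contDiff.contDiffAt.comp x
    (contDiffAt_pi.2 fun i => hv.pd i)

lemma pd_comp_gradE {g v : E2 → ℝ} {x : E2} (hg : DifferentiableAt ℝ g (gradE v x))
    (hv : ContDiffAt ℝ (⊤ : ℕ∞) v x) (i : Fin 2) :
    pd (fun y => g (gradE v y)) i x = ∑ k, pd g k (gradE v x) * pd2 v i k x := by
  have hG := hv.gradE.differentiableAt_of_smooth
  have hcoord : fderiv ℝ (gradE v) x (e2 i) = ∑ k, pd2 v i k x • e2 k := by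
    have hc : ∀ k, (fderiv ℝ (gradE v) x (e2 i)) k = pd2 v i k x := by
      intro k
      have h := ((EuclideanSpace.proj k : E2 →L[ℝ] ℝ).hasFDerivAt.comp x hG.hasFDerivAt).fderiv
      have h2 := congrArg (fun L : E2 →L[ℝ] ℝ => L (e2 i)) h
      exact h2.symm
    ext k
    rw [hc]
    fin_cases k <;> simp [e2, Fin.sum_univ_two]
  have h := (hg.hasFDerivAt.comp x hG.hasFDerivAt).fderiv
  have h2 := congrArg (fun L : E2 →L[ℝ] ℝ => L (e2 i)) h
  refine h2.trans ?_
  simp only [ContinuousLinearMap.comp_apply, hcoord, map_sum, map_smul, smul_eq_mul]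
  exact Finset.sum_congr rfl fun k _ => mul_comm _ _

lemma Filter.EventuallyEq.pd_eq {f g : E2 → ℝ} {x : E2} (h : f =ᶠ[𝓝 x] g) (i : Fin 2) :
    pd f i x = pd g i x := by
  simp only [pd, h.fderiv_eq]

lemma pd_mul {f g : E2 → ℝ} {x : E2} (hf : DifferentiableAt ℝ f x)
    (hg : DifferentiableAt ℝ g x) (i : Fin 2) :
    pd (fun y => f y * g y) i x = f x * pd g i x + pd f i x * g x := by
  simp only [pd]
  rw [fderiv_fun_mul hf hg]
  simp [mul_comm]

lemma pd_add {f g : E2 → ℝ} {x : E2} (hf : DifferentiableAt ℝ f x)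
    (hg : DifferentiableAt ℝ g x) (i : Fin 2) :
    pd (fun y => f y + g y) i x = pd f i x + pd g i x := by
  simp only [pd]
  rw [fderiv_fun_add hf hg]
  simp

lemma pd_sub {f g : E2 → ℝ} {x : E2} (hf : DifferentiableAt ℝ f x)
    (hg : DifferentiableAt ℝ g x) (i : Fin 2) :
    pd (fun y => f y - g y) i x = pd f i x - pd g i x := by
  simp only [pd]
  rw [fderiv_fun_sub hf hg]
  simp

/-- In the plane, `div ((Db) b - (div b) b) = -2 det (Db)`. -/
lemma div_jacobian_mulVec_sub {b : Fin 2 → E2 → ℝ} {x : E2}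
    (hb : ∀ i, ContDiffAt ℝ (⊤ : ℕ∞) (b i) x) :
    ∑ i, pd (fun y => (pd (b i) 0 y * b 0 y + pd (b i) 1 y * b 1 y)
        - (pd (b 0) 0 y + pd (b 1) 1 y) * b i y) i x
      = -2 * (pd (b 0) 0 x * pd (b 1) 1 x - pd (b 0) 1 x * pd (b 1) 0 x) := by
  have d0 : ∀ i, DifferentiableAt ℝ (b i) x := fun i => (hb i).differentiableAt_of_smooth
  have d1 : ∀ i j, DifferentiableAt ℝ (pd (b i) j) x :=
    fun i j => ((hb i).pd j).differentiableAt_of_smooth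
  have hs : ∀ i, pd (pd (b i) 0) 1 x = pd (pd (b i) 1) 0 x := fun i => pd2_comm (hb i) 1 0
  have key : ∀ i, pd (fun y => (pd (b i) 0 y * b 0 y + pd (b i) 1 y * b 1 y)
        - (pd (b 0) 0 y + pd (b 1) 1 y) * b i y) i x =
      ((pd (b i) 0 x * pd (b 0) i x + pd (pd (b i) 0) i x * b 0 x)
        + (pd (b i) 1 x * pd (b 1) i x + pd (pd (b i) 1) i x * b 1 x))
      - ((pd (b 0) 0 x + pd (b 1) 1 x) * pd (b i) i x
        + (pd (pd (b 0) 0) i x + pd (pd (b 1) 1) i x) * b i x) := by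
    intro i
    rw [pd_sub (((d1 i 0).fun_mul (d0 0)).fun_add ((d1 i 1).fun_mul (d0 1)))
        (((d1 0 0).fun_add (d1 1 1)).fun_mul (d0 i)),
      pd_add ((d1 i 0).fun_mul (d0 0)) ((d1 i 1).fun_mul (d0 1)),
      pd_mul (d1 i 0) (d0 0), pd_mul (d1 i 1) (d0 1),
      pd_mul ((d1 0 0).fun_add (d1 1 1)) (d0 i), pd_add (d1 0 0) (d1 1 1)]
  simp only [key, Fin.sum_univ_two, hs]
  ring

/-- divergence formula for the determinant, Lemma 2.2. -/
theorem statement1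
    (H : E2 → ℝ) (hH : ContDiff ℝ (⊤ : ℕ∞) H) (hHconv : ConvexOn ℝ univ H)
    (U : Set E2) (hUopen : IsOpen U) (hUconn : IsConnected U)
    (v : E2 → ℝ) (hv : ContDiffOn ℝ (⊤ : ℕ∞) v U) :
    ∀ x ∈ U,
      2 * (-(hessM v x).det) * (hessM H (gradE v x)).det
      = ∑ i, pd (fun y =>
            (hessM H (gradE v y)).mulVec (gradV (fun z => H (gradE v z)) y) i
              - divDpH H v y * pd H i (gradE v y)) i x := by
  intro x hx
  have hvU : ∀ y ∈ U, ContDiffAt ℝ (⊤ : ℕ∞) v y :=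
    fun y hy => hv.contDiffAt (hUopen.mem_nhds hy)
  have hHp : ∀ p, ContDiffAt ℝ (⊤ : ℕ∞) H p := fun p => hH.contDiffAt
  let b : Fin 2 → E2 → ℝ := fun i y => pd H i (gradE v y)
  have hb : ∀ i, ContDiffAt ℝ (⊤ : ℕ∞) (b i) x :=
    fun i => ((hHp _).pd i).comp x (hvU x hx).gradE
  have hJ : ∀ y ∈ U, ∀ i j, pd (b i) j y = ∑ k, pd2 H i k (gradE v y) * pd2 v j k y := by
    intro y hy i j
    refine (pd_comp_gradE ((hHp _).pd i).differentiableAt_of_smooth (hvU y hy) j).trans ?_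
    exact Finset.sum_congr rfl fun k _ => by rw [pd2_comm (hHp _) i k]; rfl
  have hfield : ∀ i, (fun y =>
      (hessM H (gradE v y)).mulVec (gradV (fun z => H (gradE v z)) y) i
        - divDpH H v y * pd H i (gradE v y)) =ᶠ[𝓝 x]
      fun y => (pd (b i) 0 y * b 0 y + pd (b i) 1 y * b 1 y)
        - (pd (b 0) 0 y + pd (b 1) 1 y) * b i y := by
    intro i
    filter_upwards [hUopen.mem_nhds hx] with y hy
    have hg : ∀ j, pd (fun z => H (gradE v z)) j y = ∑ k, b k y * pd2 v j k y :=
      pd_comp_gradE (hHp _).differentiableAt_of_smooth (hvU y hy)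
    have hdiv : divDpH H v y = pd (b 0) 0 y + pd (b 1) 1 y := by
      simp only [divDpH, Fin.sum_univ_two, b]
    rw [hdiv]
    congr 1
    simp only [Matrix.mulVec, dotProduct, hessM, gradV, Matrix.of_apply, hg, hJ y hy,
      Fin.sum_univ_two, pd2_comm (hvU y hy) 1 0]
    ring
  rw [Finset.sum_congr rfl fun i _ => (hfield i).pd_eq i, div_jacobian_mulVec_sub hb]
  simp only [hJ x hx, Matrix.det_fin_two, hessM, Matrix.of_apply, Fin.sum_univ_two]
  ring

end
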